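/- For every t ∈ (0,1], the domain of the t-Aluthge transform of S_λ is trivial: D(Δ_t(S_λ)) = {0}. -/

import Mathlib

open scoped ENNReal NNReal ComplexConjugate Classical ComplexInnerProductSpace

noncomputable section

/-- `HS V` is the Hilbert space `ℓ²(V)` of square-summable families of complex numbers
indexed by `V`. -/
abbrev HS (V : Type*) : Type _ := lp (fun _ : V => ℂ) 2

/-- A (possibly unbounded) partially defined operator in a Hilbert space `E`: a domain
together with an assignment of values.  Only the restriction of `toFun` to `dom` is
relevant (e.g. via `POp.graph`). -/
structure POp (E : Type*) [NormedAddCommGroup E] [InnerProductSpace ℂ E] where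
  dom : Set E
  toFun : E → E

namespace POp

variable {E : Type*} [NormedAddCommGroup E] [InnerProductSpace ℂ E]

/-- Composition of partially defined operators: `(A.comp B) f = A (B f)` on the natural
domain `{f ∈ dom B : B f ∈ dom A}`. -/
def comp (A B : POp E) : POp E :=
  ⟨{f | f ∈ B.dom ∧ B.toFun f ∈ A.dom}, fun f => A.toFun (B.toFun f)⟩

/-- The graph of a partially defined operator, as a subset of `E × E`. -/
def graph (A : POp E) : Set (E × E) := {p | p.1 ∈ A.dom ∧ p.2 = A.toFun p.1}

/-- The Hilbert-space adjoint of a (densely defined) partially defined operator `A`: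
`g ∈ dom A*` iff there is `h` with `⟪A f, g⟫ = ⟪f, h⟫` for all `f ∈ dom A`, and then
`A* g = h` (`h` is unique when `A` is densely defined). -/
def adj (A : POp E) : POp E :=
  ⟨{g | ∃ h : E, ∀ f ∈ A.dom, ⟪A.toFun f, g⟫ = ⟪f, h⟫},
   fun g => if h : ∃ h' : E, ∀ f ∈ A.dom, ⟪A.toFun f, g⟫ = ⟪f, h'⟫ then h.choose else 0⟩

end POp

variable {V : Type*}

/-- The element of `ℓ²(V)` with coordinates `g` (junk value `0` if `g` is not
square-summable). -/
def mkH (g : V → ℂ) : HS V := if h : Memℓp g 2 then ⟨g, h⟩ else 0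

/-- The standard orthonormal basis vector `e_u` of `ℓ²(V)`. -/
def eV (u : V) : HS V := mkH (fun v => if v = u then 1 else 0)

/-- The weighted shift `S_λ` on the directed tree encoded by the parent map `par`
(with `Chi(u) = {v : par v = u}`), with weights `lam`:
domain `{f : Σ_u (Σ_{v ∈ Chi(u)} |λ v|²)·|f u|² < ∞}` and value
`(S_λ f)(v) = λ v · f (par v)`. -/
def shiftOp (par : V → V) (lam : V → ℂ) : POp (HS V) :=
  ⟨{f | ∑' u : V, ((∑' v : {v : V // par v = u}, ((‖lam v.1‖₊ : ℝ≥0∞) ^ 2)) *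
        (‖f u‖₊ : ℝ≥0∞) ^ 2) < ⊤},
   fun f => mkH (fun v => lam v * f (par v))⟩

/-- `cW par lam u = (Σ_{v ∈ Chi(u)} |λ v|²)^{1/2}`, i.e. `c(u) = ‖S_λ e_u‖`. -/
def cW (par : V → V) (lam : V → ℂ) (u : V) : ℝ :=
  Real.sqrt (∑' v : {v : V // par v = u}, ‖lam v.1‖ ^ 2)

/-- The multiplication operator `M_α` (representing `|S_λ|^α`): domain
`{f : Σ_u c(u)^{2α}·|f u|² < ∞}` and `(M_α f)(u) = c(u)^α·f(u)`. -/
def mulOp (par : V → V) (lam : V → ℂ) (α : ℝ) : POp (HS V) :=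
  ⟨{f | Summable fun u : V => cW par lam u ^ (2 * α) * ‖f u‖ ^ 2},
   fun f => mkH (fun u => ((cW par lam u ^ α : ℝ) : ℂ) * f u)⟩

/-- The weights `π` of the partial isometry in the polar decomposition of `S_λ`:
`π v = λ v / c(par v)` if `c(par v) > 0`, and `π v = 0` otherwise. -/
def piW (par : V → V) (lam : V → ℂ) (v : V) : ℂ :=
  if 0 < cW par lam (par v) then lam v / ((cW par lam (par v) : ℝ) : ℂ) else 0

/-- The partial isometry `S_π` of the polar decomposition of `S_λ`
(a contraction defined on all of `ℓ²(V)`). -/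
def piOp (par : V → V) (lam : V → ℂ) : POp (HS V) :=
  ⟨Set.univ, fun f => mkH (fun v => piW par lam v * f (par v))⟩

/-- The weights `μ`: `μ v = (c v / c (par v))^t · λ v` if `c (par v) > 0`, else `0`. -/
def muW (par : V → V) (lam : V → ℂ) (t : ℝ) (v : V) : ℂ :=
  if 0 < cW par lam (par v)
  then (((cW par lam v / cW par lam (par v)) ^ t : ℝ) : ℂ) * lam v else 0

/-- The `t`-Aluthge transform `Δ_t(S_λ) = M_t ∘ S_π ∘ M_{1-t} = |S_λ|^t S_π |S_λ|^{1-t}`. -/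
def aluthge (par : V → V) (lam : V → ℂ) (t : ℝ) : POp (HS V) :=
  ((mulOp par lam t).comp (piOp par lam)).comp (mulOp par lam (1 - t))

/-- The defining property of a vertex of the directed tree of Section 6: there is `M ∈ ℤ`
with `g n ≥ 0` for `n ≤ M`, `g n = -1` for `n > M`, and `g n = 0` for all sufficiently
small `n`.  Such an `M` is unique. -/
def Cond (g : ℤ → ℤ) : Prop :=
  ∃ M : ℤ, (∀ n ≤ M, 0 ≤ g n) ∧ (∀ n, M < n → g n = -1) ∧ ∃ N : ℤ, ∀ n < N, g n = 0

/-- The vertex set `V` of the directed tree of Section 6. -/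
def VT : Type := {g : ℤ → ℤ // Cond g}

/-- `Mv v = M(v)`, the largest index at which `v` differs from `-1`. -/
def Mv (v : VT) : ℤ := v.2.choose

theorem Mv_spec (v : VT) :
    (∀ n ≤ Mv v, 0 ≤ v.1 n) ∧ (∀ n, Mv v < n → v.1 n = -1) ∧ ∃ N : ℤ, ∀ n < N, v.1 n = 0 :=
  v.2.choose_spec

/-- The parent map of the tree of Section 6: `par v` agrees with `v` except at `M(v)`,
where it takes the value `-1` (so that `M(par v) = M(v) - 1`). -/
def parT (v : VT) : VT :=
  ⟨fun n => if n = Mv v then -1 else v.1 n, by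
    obtain ⟨h1, h2, N, h3⟩ := Mv_spec v
    refine ⟨Mv v - 1, fun n hn => ?_, fun n hn => ?_, min N (Mv v), fun n hn => ?_⟩
    · dsimp only; rw [if_neg (by omega)]; exact h1 n (by omega)
    · dsimp only
      by_cases h : n = Mv v
      · rw [if_pos h]
      · rw [if_neg h]; exact h2 n (by omega)
    · have h' := lt_min_iff.mp hn
      dsimp only; rw [if_neg (by omega)]; exact h3 n (by omega)⟩

/-- The weights of Section 6: `λ v = 2^{Σ_{n < M(v)} v(n)} / (v(M(v)) + 1)`
(the sum has finitely many nonzero terms). -/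
def lamT (v : VT) : ℂ :=
  (((2 : ℝ) ^ (∑ᶠ n ∈ Set.Iio (Mv v), v.1 n) / ((v.1 (Mv v) : ℝ) + 1)) : ℂ)

/-- `γ = (Σ_{n=1}^∞ n^{-2})^{1/2}`. -/
def gam : ℝ := Real.sqrt (∑' n : ℕ, (1 : ℝ) / ((n : ℝ) + 1) ^ 2)

theorem mkH_apply {V : Type*} {g : V → ℂ} (h : Memℓp g 2) (v : V) : mkH g v = g v := by
  simp [mkH, dif_pos h]

theorem memℓp_two_iff_summable {V : Type*} {g : V → ℂ} :
    Memℓp g 2 ↔ Summable fun v => ‖g v‖ ^ 2 := by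
  rw [memℓp_gen_iff (by norm_num)]
  simp

theorem mkH_zero {V : Type*} : mkH (fun _ : V => (0 : ℂ)) = 0 := by
  ext v
  rw [mkH_apply (memℓp_two_iff_summable.2 (by simp))]
  rfl

theorem cW_nonneg {V : Type*} (par : V → V) (lam : V → ℂ) (u : V) : 0 ≤ cW par lam u :=
  Real.sqrt_nonneg _

theorem cW_sq {V : Type*} (par : V → V) (lam : V → ℂ) (u : V) :
    cW par lam u ^ 2 = ∑' v : {v : V // par v = u}, ‖lam v.1‖ ^ 2 :=
  Real.sq_sqrt (tsum_nonneg fun _ => by positivity)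

theorem norm_piW_of_pos {V : Type*} {par : V → V} {lam : V → ℂ} {v : V}
    (h : 0 < cW par lam (par v)) : ‖piW par lam v‖ = ‖lam v‖ / cW par lam (par v) := by
  rw [piW, if_pos h, norm_div, Complex.norm_real, Real.norm_of_nonneg h.le]

/-- `S_π` maps `ℓ²(V)` into itself. -/
theorem memℓp_piW_mul {V : Type*} {par : V → V} {lam : V → ℂ}
    (hsum : ∀ u, Summable fun v : {v : V // par v = u} => ‖lam v.1‖ ^ 2)
    (hpos : ∀ u, 0 < cW par lam u) {g : V → ℂ} (hg : Memℓp g 2) :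
    Memℓp (fun v => piW par lam v * g (par v)) 2 := by
  rw [memℓp_two_iff_summable] at hg ⊢
  rw [← (Equiv.sigmaFiberEquiv par).summable_iff]
  have hterm : ∀ (u : V) (v : {v : V // par v = u}),
      ‖piW par lam v.1 * g (par v.1)‖ ^ 2 =
        ‖lam v.1‖ ^ 2 * (‖g u‖ ^ 2 / cW par lam u ^ 2) := by
    rintro _ ⟨v, rfl⟩
    rw [norm_mul, norm_piW_of_pos (hpos _)]
    ring
  refine (summable_sigma_of_nonneg fun _ => sq_nonneg _).2 ⟨fun u => ?_, ?_⟩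
  · exact ((hsum u).mul_right (‖g u‖ ^ 2 / cW par lam u ^ 2)).congr fun v => (hterm u v).symm
  · refine hg.congr fun u => ?_
    have h := hpos u
    refine Eq.trans ?_ (tsum_congr fun v => (hterm u v).symm)
    rw [tsum_mul_right, ← cW_sq]
    field_simp

theorem memℓp_rpow_cW_mul {V : Type*} {par : V → V} {lam : V → ℂ} {α : ℝ} {f : HS V}
    (hf : f ∈ (mulOp par lam α).dom) :
    Memℓp (fun u => ((cW par lam u ^ α : ℝ) : ℂ) * f u) 2 := by
  refine memℓp_two_iff_summable.2 (Summable.congr hf fun u => ?_)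
  have hc := cW_nonneg par lam u
  rw [norm_mul, mul_pow, Complex.norm_real, Real.norm_of_nonneg (Real.rpow_nonneg hc _),
    mul_comm 2 α]
  exact congrArg (· * ‖f u‖ ^ 2) (mod_cast Real.rpow_mul_natCast hc α 2)

theorem zero_mem_dom_aluthge {V : Type*} (par : V → V) (lam : V → ℂ) (t : ℝ) :
    (0 : HS V) ∈ (aluthge par lam t).dom := by
  simp [aluthge, POp.comp, mulOp, piOp, mkH_zero, summable_zero]

theorem mem_dom_aluthge {V : Type*} {par : V → V} {lam : V → ℂ} {t : ℝ} {f : HS V}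
    (hsum : ∀ u, Summable fun v : {v : V // par v = u} => ‖lam v.1‖ ^ 2)
    (hpos : ∀ u, 0 < cW par lam u) (hf : f ∈ (aluthge par lam t).dom) :
    Summable fun v => cW par lam v ^ (2 * t) *
      (‖lam v‖ / cW par lam (par v) * (cW par lam (par v) ^ (1 - t) * ‖f (par v)‖)) ^ 2 := by
  obtain ⟨hf₁, -, hf₂⟩ := hf
  have hg := memℓp_rpow_cW_mul hf₁
  refine Summable.congr hf₂ fun v => ?_
  simp only [piOp, mulOp, mkH_apply hg, mkH_apply (memℓp_piW_mul hsum hpos hg)]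
  rw [norm_mul, norm_mul, norm_piW_of_pos (hpos _), Complex.norm_real,
    Real.norm_of_nonneg (Real.rpow_nonneg (cW_nonneg _ _ _) _)]

theorem Mv_eq_of {v : VT} {M : ℤ} (h₁ : ∀ n ≤ M, 0 ≤ v.1 n) (h₂ : ∀ n, M < n → v.1 n = -1) :
    Mv v = M := by
  obtain ⟨h₃, h₄, -⟩ := Mv_spec v
  rcases lt_trichotomy (Mv v) M with h | h | h
  · have := h₁ M le_rfl
    have := h₄ M h
    omega
  · exact h
  · have := h₃ (Mv v) le_rfl
    have := h₂ (Mv v) h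
    omega

theorem Mv_parT (v : VT) : Mv (parT v) = Mv v - 1 := by
  obtain ⟨h₁, h₂, -⟩ := Mv_spec v
  refine Mv_eq_of (fun n hn => ?_) fun n hn => ?_
  · simp only [parT]
    rw [if_neg (by omega)]
    exact h₁ n (by omega)
  · simp only [parT]
    split_ifs with h
    · rfl
    · exact h₂ n (by omega)

/-- The child of `u` taking the value `k` at `M(u) + 1`. -/
def childT (u : VT) (k : ℕ) : VT :=
  ⟨fun n => if n = Mv u + 1 then (k : ℤ) else u.1 n, by
    obtain ⟨h₁, h₂, N, h₃⟩ := Mv_spec u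
    refine ⟨Mv u + 1, fun n hn => ?_, fun n hn => ?_, min N (Mv u), fun n hn => ?_⟩
    · dsimp only
      split_ifs with h
      · positivity
      · exact h₁ n (by omega)
    · dsimp only
      rw [if_neg (by omega)]
      exact h₂ n (by omega)
    · have h := lt_min_iff.mp hn
      dsimp only
      rw [if_neg (by omega)]
      exact h₃ n (by omega)⟩

theorem childT_apply (u : VT) (k : ℕ) (n : ℤ) :
    (childT u k).1 n = if n = Mv u + 1 then (k : ℤ) else u.1 n := rfl

theorem Mv_childT (u : VT) (k : ℕ) : Mv (childT u k) = Mv u + 1 := by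
  obtain ⟨h₁, h₂, -⟩ := Mv_spec u
  refine Mv_eq_of (fun n hn => ?_) fun n hn => ?_
  · rw [childT_apply]
    split_ifs with h
    · positivity
    · exact h₁ n (by omega)
  · rw [childT_apply, if_neg (by omega)]
    exact h₂ n (by omega)

theorem parT_childT (u : VT) (k : ℕ) : parT (childT u k) = u := by
  refine Subtype.ext (funext fun n => ?_)
  simp only [parT, Mv_childT, childT_apply]
  split_ifs with h
  · exact ((Mv_spec u).2.1 n (by omega)).symm
  · rfl

theorem childT_parT (v : VT) : childT (parT v) (v.1 (Mv v)).toNat = v := by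
  refine Subtype.ext (funext fun n => ?_)
  rw [childT_apply, Mv_parT, sub_add_cancel, Int.toNat_of_nonneg ((Mv_spec v).1 _ le_rfl)]
  simp only [parT]
  split_ifs with h
  · rw [h]
  · rfl

/-- The children of `u` are indexed by their value at `M(u) + 1`. -/
def childEquiv (u : VT) : ℕ ≃ {v : VT // parT v = u} where
  toFun k := ⟨childT u k, parT_childT u k⟩
  invFun v := (v.1.1 (Mv v.1)).toNat
  left_inv k := by simp [Mv_childT, childT_apply]
  right_inv := by
    rintro ⟨v, rfl⟩
    exact Subtype.ext (childT_parT v)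

/-- The sum of the nonnegative entries of `u`. -/
def entrySum (u : VT) : ℤ := ∑ᶠ n ∈ Set.Iic (Mv u), u.1 n

theorem finsum_Iic_childT (u : VT) (k : ℕ) :
    ∑ᶠ n ∈ Set.Iic (Mv u), (childT u k).1 n = entrySum u := by
  refine finsum_mem_congr rfl fun n hn => ?_
  have hn : n ≤ Mv u := hn
  rw [childT_apply, if_neg (by omega)]

theorem entrySum_childT (u : VT) (k : ℕ) : entrySum (childT u k) = entrySum u + k := by
  obtain ⟨N, hN⟩ := (Mv_spec (childT u k)).2.2
  have hset : Set.Iic (Mv u + 1) = insert (Mv u + 1) (Set.Iic (Mv u)) := by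
    ext n
    simp only [Set.mem_Iic, Set.mem_insert_iff]
    omega
  rw [entrySum, Mv_childT, hset, finsum_mem_insert', finsum_Iic_childT, childT_apply, if_pos rfl,
    add_comm]
  · simp
  · refine (Set.finite_Icc N (Mv u)).subset fun n hn => ⟨?_, hn.1⟩
    by_contra h
    exact hn.2 (hN n (not_le.1 h))

theorem norm_lamT_childT (u : VT) (k : ℕ) :
    ‖lamT (childT u k)‖ = (2 : ℝ) ^ entrySum u / (k + 1) := by
  have hset : Set.Iio (Mv u + 1) = Set.Iic (Mv u) := by
    ext n
    simp only [Set.mem_Iic, Set.mem_Iio]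
    omega
  have h : lamT (childT u k) = (((2 : ℝ) ^ entrySum u / (k + 1) : ℝ) : ℂ) := by
    rw [lamT, Mv_childT, hset, finsum_Iic_childT, childT_apply, if_pos rfl]
    push_cast
    rfl
  rw [h, Complex.norm_real, Real.norm_of_nonneg (by positivity)]

theorem summable_one_div_add_one_sq : Summable fun k : ℕ => (1 : ℝ) / ((k : ℝ) + 1) ^ 2 := by
  simpa using (summable_nat_add_iff 1).2 (Real.summable_one_div_nat_pow.2 one_lt_two)

theorem norm_lamT_childT_sq (u : VT) (k : ℕ) :
    ‖lamT (childT u k)‖ ^ 2 = ((2 : ℝ) ^ entrySum u) ^ 2 * (1 / ((k : ℝ) + 1) ^ 2) := by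
  rw [norm_lamT_childT, div_pow, mul_one_div]

theorem summable_norm_lamT_sq (u : VT) :
    Summable fun v : {v : VT // parT v = u} => ‖lamT v.1‖ ^ 2 := by
  rw [← (childEquiv u).summable_iff]
  exact (summable_one_div_add_one_sq.mul_left _).congr fun k => (norm_lamT_childT_sq u k).symm

theorem gam_pos : 0 < gam :=
  Real.sqrt_pos.2 (summable_one_div_add_one_sq.tsum_pos (fun _ => by positivity) 0 (by norm_num))

theorem cW_parT_lamT (u : VT) : cW parT lamT u = (2 : ℝ) ^ entrySum u * gam := by
  rw [cW, ← (childEquiv u).tsum_eq]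
  simp only [childEquiv, Equiv.coe_fn_mk, norm_lamT_childT_sq]
  rw [tsum_mul_left, Real.sqrt_mul (by positivity), Real.sqrt_sq (by positivity), gam]

theorem cW_parT_lamT_pos (u : VT) : 0 < cW parT lamT u := by
  rw [cW_parT_lamT]
  exact mul_pos (by positivity) gam_pos

theorem cW_childT (u : VT) (k : ℕ) :
    cW parT lamT (childT u k) = cW parT lamT u * 2 ^ k := by
  rw [cW_parT_lamT, cW_parT_lamT, entrySum_childT, zpow_add₀ two_ne_zero, zpow_natCast]
  ring

theorem eq_zero_of_summable_mul_pow_div_sq {b C : ℝ} (hb : 1 < b)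
    (h : Summable fun k : ℕ => C * (b ^ k / ((k : ℝ) + 1) ^ 2)) : C = 0 := by
  have h₁ := (Filter.tendsto_add_atTop_iff_nat 1).2
    (tendsto_pow_const_div_const_pow_of_one_lt 2 hb)
  have h₂ := h.tendsto_atTop_zero.mul h₁
  have hb₀ : b ≠ 0 := by positivity
  have h₃ : (fun k : ℕ => C * (b ^ k / ((k : ℝ) + 1) ^ 2) *
      (((k + 1 : ℕ) : ℝ) ^ 2 / b ^ (k + 1))) = fun _ => C / b := by
    funext k
    push_cast
    field_simp
    ring
  rw [h₃, zero_mul, tendsto_const_nhds_iff] at h₂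
  exact (div_eq_zero_iff.1 h₂).resolve_right hb₀

/-- Proposition 6.3: on the tree of Section 6, for every `t ∈ (0,1]`
the `t`-Aluthge transform of `S_λ` has trivial domain: `D(Δ_t(S_λ)) = {0}`. -/
theorem statement_12 (t : ℝ) (ht : t ∈ Set.Ioc (0 : ℝ) 1) :
    (aluthge parT lamT t).dom = {0} := by
  refine Set.Subset.antisymm (fun f hf => ?_)
    (Set.singleton_subset_iff.2 (zero_mem_dom_aluthge _ _ _))
  rw [Set.mem_singleton_iff]
  ext u
  have hc := cW_parT_lamT_pos u
  have hs := ((mem_dom_aluthge summable_norm_lamT_sq cW_parT_lamT_pos hf).comp_injective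
    (Subtype.val_injective.comp (childEquiv u).injective))
  have hC := eq_zero_of_summable_mul_pow_div_sq
    (b := (2 : ℝ) ^ (2 * t))
    (C := cW parT lamT u ^ (2 * t) *
      ((2 : ℝ) ^ entrySum u / cW parT lamT u * (cW parT lamT u ^ (1 - t) * ‖f u‖)) ^ 2)
    (Real.one_lt_rpow one_lt_two (by linarith [ht.1])) (hs.congr fun k => ?_)
  · by_contra hne
    have : 0 < ‖f u‖ := norm_pos_iff.2 hne
    exact absurd hC (by positivity)
  · simp only [Function.comp_apply, childEquiv, Equiv.coe_fn_mk, parT_childT, norm_lamT_childT,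
      cW_childT]
    rw [Real.mul_rpow hc.le (by positivity), ← Real.rpow_natCast_mul zero_le_two,
      ← Real.rpow_mul_natCast zero_le_two, mul_comm (k : ℝ)]
    field_simp
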